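/- Let m ≥ 1 and let p > 0 be odd with gcd(m, 2p) = 1, and let π = (ℤ/mℤ) × D*₄ₚ. If p ≢ 0 mod 3 and m ≢ 0 mod 3, then dim_ℂ 𝒜_Θ^odd(ℂπ) = (1/6)m²p² + (1/2)m²p + (2/3)m² + (3/2)mp + (1/6)p² + (1/2)m + 1/2 and dim_ℂ 𝒜_Θ^odd(Ker ε) = (1/6)m²p² + (1/2)m²p + (2/3)m² + mp + (1/6)p² − m − (1/2)p; otherwise dim_ℂ 𝒜_Θ^odd(ℂπ) = (1/6)m²p² + (1/2)m²p + (2/3)m² + (3/2)mp + (1/6)p² + (1/2)m + 5/6 and dim_ℂ 𝒜_Θ^odd(Ker ε) = (1/6)m²p² + (1/2)m²p + (2/3)m² + mp + (1/6)p² − m − (1/2)p + 1/3. -/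

import Mathlib

/-!
Statement 3: dimensions of `𝒜_Θ^odd(ℂπ)` and `𝒜_Θ^odd(Ker ε)` for
`π = (ℤ/mℤ) × D*₄ₚ` with `p` odd, where `D*₄ₚ` is the binary dihedral (dicyclic) group
of order `4p` (Mathlib's `QuaternionGroup p`).

Identifying `(ℂπ)^{⊗3}` with functions `π³ → ℂ`, `dim 𝒜_Θ^odd(ℂπ)` (resp.
`dim 𝒜_Θ^odd(Ker ε)`) is the dimension of the space of functions `π³ → ℂ`
(resp. of such functions with vanishing marginal sums, cutting out `(Ker ε)^{⊗3}`)
invariant under permutations of the coordinates, the two-sided action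
`(x,y,z) ↦ (gxh⁻¹,gyh⁻¹,gzh⁻¹)` and coordinatewise inversion.
-/

open scoped BigOperators

/-- The dimension `dim_ℂ 𝒜_Θ^odd(ℂπ)`. -/
noncomputable def dimAThetaOddGroupAlgebra (G : Type*) [Group G] : ℕ :=
  Module.finrank ℂ ↥(Submodule.span ℂ
    { f : G × G × G → ℂ |
      (∀ x y z : G, f (y, x, z) = f (x, y, z)) ∧
      (∀ x y z : G, f (x, z, y) = f (x, y, z)) ∧
      (∀ g h x y z : G, f (g * x * h⁻¹, g * y * h⁻¹, g * z * h⁻¹) = f (x, y, z)) ∧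
      (∀ x y z : G, f (x⁻¹, y⁻¹, z⁻¹) = f (x, y, z)) })

/-- The dimension `dim_ℂ 𝒜_Θ^odd(Ker ε)`. -/
noncomputable def dimAThetaOddKerAug (G : Type*) [Group G] : ℕ :=
  Module.finrank ℂ ↥(Submodule.span ℂ
    { f : G × G × G → ℂ |
      (∀ x y z : G, f (y, x, z) = f (x, y, z)) ∧
      (∀ x y z : G, f (x, z, y) = f (x, y, z)) ∧
      (∀ g h x y z : G, f (g * x * h⁻¹, g * y * h⁻¹, g * z * h⁻¹) = f (x, y, z)) ∧
      (∀ x y z : G, f (x⁻¹, y⁻¹, z⁻¹) = f (x, y, z)) ∧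
      (∀ y z : G, ∑ᶠ x : G, f (x, y, z) = 0) ∧
      (∀ x z : G, ∑ᶠ y : G, f (x, y, z) = 0) ∧
      (∀ x y : G, ∑ᶠ z : G, f (x, y, z) = 0) })

open Finset

/-- The homomorphism `ℤˣ →* M` sending `-1` to a given involution. -/
def involutionHom {M : Type*} [Monoid M] (a : M) (ha : a * a = 1) : ℤˣ →* M where
  toFun u := if u = 1 then 1 else a
  map_one' := by simp
  map_mul' u v := by
    rcases Int.units_eq_one_or u with rfl | rfl <;> rcases Int.units_eq_one_or v with rfl | rfl <;>
      simp [ha]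

/-- The group `(G × G) ⋊ ℤ/2` of two-sided translations and inversion. -/
abbrev TwoSided (G : Type*) [Group G] : Type _ :=
  (G × G) ⋊[involutionHom (MulEquiv.prodComm : MulAut (G × G)) rfl] ℤˣ

namespace TwoSided

variable {G : Type*} [Group G]

instance : MulAction (TwoSided G) G where
  smul γ x := γ.left.1 * (if γ.right = 1 then x else x⁻¹) * γ.left.2⁻¹
  one_smul x := by
    change (1 : TwoSided G).left.1 * (if (1 : TwoSided G).right = 1 then x else x⁻¹) *
      (1 : TwoSided G).left.2⁻¹ = x
    simp
  mul_smul := by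
    rintro ⟨⟨g, h⟩, u⟩ ⟨⟨g', h'⟩, v⟩ x
    change (g * (involutionHom (MulEquiv.prodComm : MulAut (G × G)) rfl u (g', h')).1) *
      (if u * v = 1 then x else x⁻¹) *
      (h * (involutionHom (MulEquiv.prodComm : MulAut (G × G)) rfl u (g', h')).2)⁻¹ =
      g * (if u = 1 then g' * (if v = 1 then x else x⁻¹) * h'⁻¹ else
        (g' * (if v = 1 then x else x⁻¹) * h'⁻¹)⁻¹) * h⁻¹
    rcases Int.units_eq_one_or u with rfl | rfl <;> rcases Int.units_eq_one_or v with rfl | rfl <;>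
      simp [involutionHom, mul_assoc]

lemma smul_one_mk (g h x : G) : (⟨(g, h), 1⟩ : TwoSided G) • x = g * x * h⁻¹ := rfl

lemma smul_neg_one_mk (g h x : G) : (⟨(g, h), -1⟩ : TwoSided G) • x = g * x⁻¹ * h⁻¹ := rfl

instance [Fintype G] : Fintype (TwoSided G) :=
  Fintype.ofEquiv _ SemidirectProduct.equivProd.symm

lemma card [Fintype G] : Fintype.card (TwoSided G) = 2 * Fintype.card G ^ 2 := by
  rw [Fintype.card_congr SemidirectProduct.equivProd]
  simp; ring

lemma sum_eq [Fintype G] {M : Type*} [AddCommMonoid M] (F : TwoSided G → M) :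
    ∑ γ, F γ = ∑ g, ∑ h, F ⟨(g, h), 1⟩ + ∑ g, ∑ h, F ⟨(g, h), -1⟩ := by
  rw [← SemidirectProduct.equivProd.symm.sum_comp]
  rw [Fintype.sum_prod_type_right]
  have : (univ : Finset ℤˣ) = {1, -1} := by decide
  rw [this, sum_insert (by decide), sum_singleton, Fintype.sum_prod_type, Fintype.sum_prod_type]
  rfl

lemma mk_one_mul (g h g' h' : G) :
    (⟨(g, h), 1⟩ : TwoSided G) * ⟨(g', h'), 1⟩ = ⟨(g * g', h * h'), 1⟩ := by
  ext <;> simp [SemidirectProduct.mul_left]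

lemma mk_one_pow (g h : G) (n : ℕ) :
    (⟨(g, h), 1⟩ : TwoSided G) ^ n = ⟨(g ^ n, h ^ n), 1⟩ := by
  induction n with
  | zero => simp; rfl
  | succ n ih => rw [pow_succ, ih, mk_one_mul, pow_succ, pow_succ]

lemma mk_neg_one_pow_two (g h : G) :
    (⟨(g, h), -1⟩ : TwoSided G) ^ 2 = ⟨(g * h, h * g), 1⟩ := by
  rw [pow_two]; rfl

lemma mk_neg_one_pow_three (g h : G) :
    (⟨(g, h), -1⟩ : TwoSided G) ^ 3 = ⟨(g * h * g, h * g * h), -1⟩ := by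
  rw [pow_succ, mk_neg_one_pow_two]; rfl

end TwoSided

section
variable {Γ X ι : Type*} [Group Γ] [MulAction Γ X]

instance prodPermMulAction : MulAction (Γ × Equiv.Perm ι) (ι → X) where
  smul k v i := k.1 • v (k.2⁻¹ i)
  one_smul v := by funext i; exact one_smul _ _
  mul_smul k l v := by
    funext i
    change (k.1 * l.1) • v ((k.2 * l.2)⁻¹ i) = k.1 • l.1 • v (l.2⁻¹ (k.2⁻¹ i))
    rw [mul_smul, mul_inv_rev, Equiv.Perm.mul_apply]

lemma prodPerm_smul_apply (k : Γ × Equiv.Perm ι) (v : ι → X) (i : ι) :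
    (k • v) i = k.1 • v (k.2⁻¹ i) := rfl

lemma sum_perm_fin_three {M : Type*} [AddCommMonoid M] (F : Equiv.Perm (Fin 3) → M) :
    ∑ σ, F σ = F 1 + F (Equiv.swap 0 1) + F (Equiv.swap 0 2) + F (Equiv.swap 1 2) + F (finRotate 3)
      + F (finRotate 3)⁻¹ := by
  have : (univ : Finset (Equiv.Perm (Fin 3))) = {1, Equiv.swap 0 1, Equiv.swap 0 2,
    Equiv.swap 1 2, finRotate 3, (finRotate 3)⁻¹} := by decide
  rw [this]
  iterate 5 rw [sum_insert (by decide)]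
  rw [sum_singleton]
  simp only [add_assoc]

lemma sum_perm_fin_two {M : Type*} [AddCommMonoid M] (F : Equiv.Perm (Fin 2) → M) :
    ∑ σ, F σ = F 1 + F (Equiv.swap 0 1) := by
  have : (univ : Finset (Equiv.Perm (Fin 2))) = {1, Equiv.swap 0 1} := by decide
  rw [this, sum_insert (by decide), sum_singleton]

lemma card_fixedBy_one [Fintype ι] (γ : Γ) :
    Nat.card (MulAction.fixedBy (ι → X) (γ, (1 : Equiv.Perm ι))) =
      Nat.card (MulAction.fixedBy X γ) ^ Fintype.card ι := by
  rw [← Nat.card_eq_fintype_card, ← Nat.card_fun]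
  exact Nat.card_congr
    { toFun := fun v i => ⟨v.1 i, congrFun v.2 i⟩
      invFun := fun w => ⟨fun i => (w i).1, funext fun i => (w i).2⟩ }

lemma card_fixedBy_conj (γ : Γ) (σ τ : Equiv.Perm ι) :
    Nat.card (MulAction.fixedBy (ι → X) (γ, τ * σ * τ⁻¹)) =
      Nat.card (MulAction.fixedBy (ι → X) (γ, σ)) := by
  have h : (γ, τ * σ * τ⁻¹) = ((1, τ) : Γ × Equiv.Perm ι) * (γ, σ) * (1, τ)⁻¹ := by simp
  rw [h, ← MulAction.smul_fixedBy]
  exact Nat.card_congr (Equiv.Set.image _ _ (MulAction.injective _)).symm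

lemma card_fixedBy_swap_fin_two (γ : Γ) :
    Nat.card (MulAction.fixedBy (Fin 2 → X) (γ, Equiv.swap (0 : Fin 2) 1)) =
      Nat.card (MulAction.fixedBy X (γ ^ 2)) := by
  refine Nat.card_congr
    { toFun := fun v => ⟨v.1 0, ?_⟩
      invFun := fun x => ⟨![x.1, γ • x.1], ?_⟩
      left_inv := ?_
      right_inv := fun x => rfl }
  · have h0 : γ • v.1 1 = v.1 0 := congrFun v.2 0
    have h1 : γ • v.1 0 = v.1 1 := congrFun v.2 1
    rw [MulAction.mem_fixedBy, pow_two, mul_smul, h1, h0]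
  · have hx : γ ^ 2 • x.1 = x.1 := x.2
    simp only [pow_two, mul_smul] at hx
    funext i
    fin_cases i
    · exact hx
    · rfl
  · intro v
    have h1 : γ • v.1 0 = v.1 1 := congrFun v.2 1
    ext i
    fin_cases i
    · rfl
    · exact h1

lemma card_fixedBy_swap_fin_three (γ : Γ) :
    Nat.card (MulAction.fixedBy (Fin 3 → X) (γ, Equiv.swap (0 : Fin 3) 1)) =
      Nat.card (MulAction.fixedBy X γ) * Nat.card (MulAction.fixedBy X (γ ^ 2)) := by
  rw [← Nat.card_prod]
  refine Nat.card_congr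
    { toFun := fun v => ⟨⟨v.1 2, congrFun v.2 2⟩, ⟨v.1 0, ?_⟩⟩
      invFun := fun x => ⟨![x.2.1, γ • x.2.1, x.1.1], ?_⟩
      left_inv := ?_
      right_inv := fun x => rfl }
  · have h0 : γ • v.1 1 = v.1 0 := congrFun v.2 0
    have h1 : γ • v.1 0 = v.1 1 := congrFun v.2 1
    rw [MulAction.mem_fixedBy, pow_two, mul_smul, h1, h0]
  · have hx : γ ^ 2 • x.2.1 = x.2.1 := x.2.2
    simp only [pow_two, mul_smul] at hx
    funext i
    fin_cases i
    · exact hx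
    · rfl
    · exact x.1.2
  · intro v
    have h1 : γ • v.1 0 = v.1 1 := congrFun v.2 1
    ext i
    fin_cases i
    · rfl
    · exact h1
    · rfl

lemma card_fixedBy_finRotate_three (γ : Γ) :
    Nat.card (MulAction.fixedBy (Fin 3 → X) (γ, finRotate 3)) =
      Nat.card (MulAction.fixedBy X (γ ^ 3)) := by
  refine Nat.card_congr
    { toFun := fun v => ⟨v.1 0, ?_⟩
      invFun := fun x => ⟨![x.1, γ • x.1, γ • γ • x.1], ?_⟩
      left_inv := ?_
      right_inv := fun x => rfl }
  · have h0 : γ • v.1 2 = v.1 0 := congrFun v.2 0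
    have h1 : γ • v.1 0 = v.1 1 := congrFun v.2 1
    have h2 : γ • v.1 1 = v.1 2 := congrFun v.2 2
    rw [MulAction.mem_fixedBy, pow_succ, pow_two, mul_smul, mul_smul, h1, h2, h0]
  · have hx : γ ^ 3 • x.1 = x.1 := x.2
    simp only [pow_succ, pow_zero, one_mul, mul_smul] at hx
    funext i
    fin_cases i
    · exact hx
    · rfl
    · rfl
  · intro v
    have h1 : γ • v.1 0 = v.1 1 := congrFun v.2 1
    have h2 : γ • v.1 1 = v.1 2 := congrFun v.2 2
    ext i
    fin_cases i
    · rfl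
    · exact h1
    · change γ • γ • v.1 0 = v.1 2
      rw [h1, h2]

lemma sum_card_fixedBy_perm [Fintype Γ] [Finite X] [Fintype ι] [DecidableEq ι] :
    ∑ γ : Γ, ∑ σ : Equiv.Perm ι, Nat.card (MulAction.fixedBy (ι → X) (γ, σ)) =
      Nat.card (MulAction.orbitRel.Quotient (Γ × Equiv.Perm ι) (ι → X)) *
        (Fintype.card Γ * (Fintype.card ι).factorial) := by
  classical
  have := Fintype.ofFinite X
  have : Fintype (MulAction.orbitRel.Quotient (Γ × Equiv.Perm ι) (ι → X)) := Fintype.ofFinite _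
  have h := MulAction.sum_card_fixedBy_eq_card_orbits_mul_card_group (Γ × Equiv.Perm ι) (ι → X)
  rw [Fintype.sum_prod_type, Fintype.card_prod, Fintype.card_perm] at h
  simpa only [Nat.card_eq_fintype_card] using h

lemma card_orbits_fin_two [Fintype Γ] [Finite X] :
    Nat.card (MulAction.orbitRel.Quotient (Γ × Equiv.Perm (Fin 2)) (Fin 2 → X)) *
        (2 * Fintype.card Γ) =
      ∑ γ : Γ, (Nat.card (MulAction.fixedBy X γ) ^ 2 +
        Nat.card (MulAction.fixedBy X (γ ^ 2))) := by
  rw [mul_comm 2]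
  refine sum_card_fixedBy_perm.symm.trans (sum_congr rfl fun γ _ => ?_)
  rw [sum_perm_fin_two, card_fixedBy_one, card_fixedBy_swap_fin_two, Fintype.card_fin]

lemma card_orbits_fin_three [Fintype Γ] [Finite X] :
    Nat.card (MulAction.orbitRel.Quotient (Γ × Equiv.Perm (Fin 3)) (Fin 3 → X)) *
        (6 * Fintype.card Γ) =
      ∑ γ : Γ, (Nat.card (MulAction.fixedBy X γ) ^ 3 +
        3 * (Nat.card (MulAction.fixedBy X γ) * Nat.card (MulAction.fixedBy X (γ ^ 2))) +
        2 * Nat.card (MulAction.fixedBy X (γ ^ 3))) := by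
  rw [mul_comm 6]
  refine sum_card_fixedBy_perm.symm.trans (sum_congr rfl fun γ _ => ?_)
  have h02 : Equiv.swap (0 : Fin 3) 2 =
      Equiv.swap 1 2 * Equiv.swap 0 1 * (Equiv.swap 1 2)⁻¹ := by decide
  have h12 : Equiv.swap (1 : Fin 3) 2 =
      Equiv.swap 0 2 * Equiv.swap 0 1 * (Equiv.swap 0 2)⁻¹ := by decide
  have hrot : (finRotate 3)⁻¹ = Equiv.swap 0 1 * finRotate 3 * (Equiv.swap 0 1)⁻¹ := by decide
  rw [sum_perm_fin_three, hrot, card_fixedBy_conj, h12, card_fixedBy_conj, h02,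
    card_fixedBy_conj, card_fixedBy_one, card_fixedBy_swap_fin_three,
    card_fixedBy_finRotate_three, Fintype.card_fin]
  ring

end

lemma sum_sum_mul_left {G : Type*} [Group G] [Fintype G] (Φ : G → G → ℕ) (Ψ : G → ℕ)
    (h : ∀ g k, Φ g (g⁻¹ * k) = Ψ k) :
    ∑ g, ∑ h, Φ g h = Fintype.card G * ∑ k, Ψ k := by
  have (g : G) : ∑ h, Φ g h = ∑ k, Ψ k := by
    rw [← Equiv.sum_comp (Equiv.mulLeft g⁻¹)]
    exact sum_congr rfl fun k _ => h g k
  simp [this]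

section counting

variable {G : Type*} [Group G] [Fintype G] [DecidableEq G]

/-- The number of elements conjugating `g` to `h`. -/
def conjCount (g h : G) : ℕ := #{x : G | x⁻¹ * g * x = h}

/-- The order of the centralizer of `g`. -/
def centCount (g : G) : ℕ := #{x : G | x * g = g * x}

/-- The number of `n`-th roots of `k`. -/
def rootCount (n : ℕ) (k : G) : ℕ := #{x : G | x ^ n = k}

lemma conjCount_conj (g x : G) : conjCount g (x⁻¹ * g * x) = centCount g := by
  refine card_bij' (fun y _ => y * x⁻¹) (fun y _ => y * x) ?_ ?_ (by simp) (by simp)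
  · intro y hy
    simp only [mem_filter_univ] at hy ⊢
    have : y * (y⁻¹ * g * y) * x⁻¹ = y * (x⁻¹ * g * x) * x⁻¹ := by rw [hy]
    simpa [mul_assoc] using this.symm
  · intro y hy
    simp only [mem_filter_univ] at hy ⊢
    rw [mul_inv_rev, mul_assoc, mul_assoc, ← mul_assoc g, ← hy]
    group

lemma sum_conjCount_mul (Φ : G → G → ℕ) (Ψ : G → ℕ) (h : ∀ g x, Φ g (x⁻¹ * g * x) = Ψ g) :
    ∑ g, ∑ h, conjCount g h * Φ g h = Fintype.card G * ∑ g, Ψ g := by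
  rw [mul_sum]
  refine sum_congr rfl fun g _ => ?_
  calc ∑ h, conjCount g h * Φ g h
      = ∑ h, ∑ x : G, if x⁻¹ * g * x = h then Φ g h else 0 := by
        refine sum_congr rfl fun h _ => ?_
        rw [conjCount, card_filter, sum_mul]
        simp
    _ = ∑ x : G, ∑ h, if x⁻¹ * g * x = h then Φ g h else 0 := sum_comm
    _ = Fintype.card G * Ψ g := by simp [h]

lemma sum_conjCount_pow (n : ℕ) :
    ∑ g : G, ∑ h : G, conjCount (g ^ n) (h ^ n) =
      Fintype.card G * ∑ g : G, rootCount n (g ^ n) := by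
  calc ∑ g : G, ∑ h : G, conjCount (g ^ n) (h ^ n)
      = ∑ g : G, ∑ h : G, ∑ x : G, if h ^ n = (x⁻¹ * g * x) ^ n then 1 else 0 := by
        refine sum_congr rfl fun g _ => sum_congr rfl fun h _ => ?_
        rw [conjCount, card_filter]
        refine sum_congr rfl fun x _ => ?_
        have := conj_pow (i := n) (a := x⁻¹) (b := g)
        rw [inv_inv] at this
        simp only [this, eq_comm]
    _ = ∑ x : G, ∑ g : G, rootCount n ((x⁻¹ * g * x) ^ n) := by
        simp_rw [rootCount, card_filter]
        rw [sum_congr rfl fun g _ => sum_comm, sum_comm]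
    _ = ∑ x : G, ∑ g : G, rootCount n (g ^ n) := by
        refine sum_congr rfl fun x _ => ?_
        have := (MulAut.conj x⁻¹).toEquiv.sum_comp (fun g => rootCount n (g ^ n))
        simpa using this
    _ = _ := by simp

lemma sum_rootCount_mul (n : ℕ) (Φ : G → ℕ) :
    ∑ k, rootCount n k * Φ k = ∑ u, Φ (u ^ n) := by
  calc ∑ k, rootCount n k * Φ k = ∑ k, ∑ u : G, if u ^ n = k then Φ k else 0 := by
        refine sum_congr rfl fun h _ => ?_
        rw [rootCount, card_filter, sum_mul]
        simp
    _ = ∑ u : G, ∑ k, if u ^ n = k then Φ k else 0 := sum_comm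
    _ = _ := by simp

namespace TwoSided

lemma card_fixedBy_mk_one (g h : G) :
    Nat.card (MulAction.fixedBy G (⟨(g, h), 1⟩ : TwoSided G)) = conjCount g h := by
  rw [conjCount, ← Nat.subtype_card _ (fun x => mem_filter_univ x)]
  refine Nat.card_congr (Equiv.subtypeEquivRight fun x => ?_)
  rw [MulAction.mem_fixedBy, smul_one_mk, mul_inv_eq_iff_eq_mul, mul_assoc, inv_mul_eq_iff_eq_mul]

lemma card_fixedBy_mk_neg_one (g h : G) :
    Nat.card (MulAction.fixedBy G (⟨(g, h), -1⟩ : TwoSided G)) = rootCount 2 (g * h) := by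
  rw [rootCount, ← Nat.subtype_card _ (fun x => mem_filter_univ x)]
  refine Nat.card_congr (Equiv.subtypeEquiv (Equiv.mulRight h) fun x => ?_)
  rw [MulAction.mem_fixedBy, smul_neg_one_mk, mul_inv_eq_iff_eq_mul, mul_inv_eq_iff_eq_mul,
    Equiv.coe_mulRight, pow_two, ← mul_assoc, mul_left_inj, eq_comm]

lemma sum_rootCount_mul_conjCount (Φ : G → ℕ) :
    ∑ g : G, ∑ h : G, Φ (g * h) * conjCount (g * h) (h * g) =
      Fintype.card G * ∑ k, Φ k * centCount k :=
  sum_sum_mul_left _ _ fun g k => by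
    rw [mul_inv_cancel_left, conjCount_conj]

lemma card_orbits_fin_two :
    Nat.card (MulAction.orbitRel.Quotient (TwoSided G × Equiv.Perm (Fin 2)) (Fin 2 → G)) *
        (2 * Fintype.card G) = ∑ k : G, centCount k + ∑ k : G, rootCount 2 k ^ 2 := by
  have h := _root_.card_orbits_fin_two (Γ := TwoSided G) (X := G)
  rw [card, sum_eq] at h
  simp only [mk_one_pow, mk_neg_one_pow_two, card_fixedBy_mk_one, card_fixedBy_mk_neg_one,
    sum_add_distrib] at h
  have h1 : ∑ g : G, ∑ h : G, conjCount g h ^ 2 = Fintype.card G * ∑ k : G, centCount k := by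
    simp only [pow_two]
    exact sum_conjCount_mul _ _ conjCount_conj
  have h2 : ∑ g : G, ∑ h : G, rootCount 2 (g * h) ^ 2 =
      Fintype.card G * ∑ k : G, rootCount 2 k ^ 2 :=
    sum_sum_mul_left _ _ fun g k => by rw [mul_inv_cancel_left]
  have h3 := sum_rootCount_mul_conjCount (G := G) (fun _ => 1)
  simp only [one_mul] at h3
  have h4 : ∑ g : G, rootCount 2 (g ^ 2) = ∑ k : G, rootCount 2 k ^ 2 := by
    simp only [pow_two (rootCount 2 _), sum_rootCount_mul]
  rw [h1, sum_conjCount_pow, h2, h3, h4] at h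
  have hG : 0 < 2 * Fintype.card G := mul_pos two_pos Fintype.card_pos
  refine Nat.eq_of_mul_eq_mul_left hG ?_
  linarith

lemma card_orbits_fin_three :
    Nat.card (MulAction.orbitRel.Quotient (TwoSided G × Equiv.Perm (Fin 3)) (Fin 3 → G)) *
        (12 * Fintype.card G) =
      ∑ k : G, centCount k ^ 2 + 6 * ∑ k : G, centCount (k ^ 2) +
        2 * ∑ k : G, rootCount 3 (k ^ 3) + ∑ k : G, rootCount 2 k ^ 3 +
        2 * ∑ k : G, rootCount 2 (k ^ 3) := by
  have h := _root_.card_orbits_fin_three (Γ := TwoSided G) (X := G)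
  rw [card, sum_eq] at h
  simp only [mk_one_pow, mk_neg_one_pow_two, mk_neg_one_pow_three, card_fixedBy_mk_one,
    card_fixedBy_mk_neg_one, sum_add_distrib, ← mul_sum] at h
  have h1 : ∑ g : G, ∑ h : G, conjCount g h ^ 3 = Fintype.card G * ∑ k : G, centCount k ^ 2 := by
    simp only [pow_succ' _ 2]
    exact sum_conjCount_mul _ _ fun g x => by rw [conjCount_conj]
  have h2 : ∑ g : G, ∑ h : G, conjCount g h * conjCount (g ^ 2) (h ^ 2) =
      Fintype.card G * ∑ k : G, centCount (k ^ 2) :=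
    sum_conjCount_mul _ _ fun g x => by
      have := conj_pow (i := 2) (a := x⁻¹) (b := g)
      rw [inv_inv] at this
      rw [this, conjCount_conj]
  have h3 : ∑ g : G, ∑ h : G, rootCount 2 (g * h) ^ 3 =
      Fintype.card G * ∑ k : G, rootCount 2 k ^ 3 :=
    sum_sum_mul_left _ _ fun g k => by rw [mul_inv_cancel_left]
  have h4 := sum_rootCount_mul_conjCount (G := G) (rootCount 2)
  rw [sum_rootCount_mul] at h4
  have h5 : ∑ g : G, ∑ h : G, rootCount 2 (g * h * g * (h * g * h)) =
      Fintype.card G * ∑ k : G, rootCount 2 (k ^ 3) :=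
    sum_sum_mul_left _ _ fun g k => by congr 1; simp [pow_succ, mul_assoc]
  rw [h1, h2, sum_conjCount_pow, h3, h4, h5] at h
  have hG : 0 < Fintype.card G := Fintype.card_pos
  refine Nat.eq_of_mul_eq_mul_left hG ?_
  linarith

end TwoSided

end counting

section dimensions

variable (G : Type*) [Group G]

/-- The symmetric functions on `G × G × G` invariant under translations and inversion. -/
def invariantFunctions₃ : Submodule ℂ (G × G × G → ℂ) where
  carrier :=
    { f | (∀ x y z : G, f (y, x, z) = f (x, y, z)) ∧
      (∀ x y z : G, f (x, z, y) = f (x, y, z)) ∧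
      (∀ g h x y z : G, f (g * x * h⁻¹, g * y * h⁻¹, g * z * h⁻¹) = f (x, y, z)) ∧
      (∀ x y z : G, f (x⁻¹, y⁻¹, z⁻¹) = f (x, y, z)) }
  zero_mem' := by simp
  add_mem' := by
    rintro f f' ⟨h1, h2, h3, h4⟩ ⟨h1', h2', h3', h4'⟩
    simp only [Set.mem_ofPred_eq, Pi.add_apply]
    exact ⟨fun _ _ _ => by rw [h1, h1'], fun _ _ _ => by rw [h2, h2'],
      fun _ _ _ _ _ => by rw [h3, h3'], fun _ _ _ => by rw [h4, h4']⟩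
  smul_mem' := by
    rintro c f ⟨h1, h2, h3, h4⟩
    simp only [Set.mem_ofPred_eq, Pi.smul_apply]
    exact ⟨fun _ _ _ => by rw [h1], fun _ _ _ => by rw [h2],
      fun _ _ _ _ _ => by rw [h3], fun _ _ _ => by rw [h4]⟩

/-- The symmetric functions on `G × G` invariant under translations and inversion. -/
def invariantFunctions₂ : Submodule ℂ (G × G → ℂ) where
  carrier :=
    { f | (∀ x y : G, f (y, x) = f (x, y)) ∧
      (∀ g h x y : G, f (g * x * h⁻¹, g * y * h⁻¹) = f (x, y)) ∧
      (∀ x y : G, f (x⁻¹, y⁻¹) = f (x, y)) }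
  zero_mem' := by simp
  add_mem' := by
    rintro f f' ⟨h1, h2, h3⟩ ⟨h1', h2', h3'⟩
    simp only [Set.mem_ofPred_eq, Pi.add_apply]
    exact ⟨fun _ _ => by rw [h1, h1'], fun _ _ _ _ => by rw [h2, h2'],
      fun _ _ => by rw [h3, h3']⟩
  smul_mem' := by
    rintro c f ⟨h1, h2, h3⟩
    simp only [Set.mem_ofPred_eq, Pi.smul_apply]
    exact ⟨fun _ _ => by rw [h1], fun _ _ _ _ => by rw [h2], fun _ _ => by rw [h3]⟩

/-- Summation over the first coordinate. -/
def sumFirst [Fintype G] : (G × G × G → ℂ) →ₗ[ℂ] (G × G → ℂ) where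
  toFun f q := ∑ x, f (x, q.1, q.2)
  map_add' f f' := by ext q; simp [sum_add_distrib]
  map_smul' c f := by ext q; simp [mul_sum]

variable {G}

lemma finrank_range_funLeft {X Y : Type*} [Finite Y] (q : X → Y) (hq : Function.Surjective q) :
    Module.finrank ℂ (LinearMap.range (LinearMap.funLeft ℂ ℂ q)) = Nat.card Y := by
  have := Fintype.ofFinite Y
  rw [LinearMap.finrank_range_of_inj (LinearMap.funLeft_injective_of_surjective ℂ ℂ q hq),
    Module.finrank_fintype_fun_eq_card, Nat.card_eq_fintype_card]

lemma finrank_invariantFunctions₃ [Finite G] :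
    Module.finrank ℂ (invariantFunctions₃ G) =
      Nat.card (MulAction.orbitRel.Quotient (TwoSided G × Equiv.Perm (Fin 3)) (Fin 3 → G)) := by
  let q : G × G × G →
      MulAction.orbitRel.Quotient (TwoSided G × Equiv.Perm (Fin 3)) (Fin 3 → G) :=
    fun t => Quotient.mk'' ![t.1, t.2.1, t.2.2]
  have eta (v : Fin 3 → G) : ![v 0, v 1, v 2] = v := by
    ext i; fin_cases i <;> rfl
  have hq : Function.Surjective q := by
    intro o
    induction o using Quotient.inductionOn' with
    | h v => exact ⟨(v 0, v 1, v 2), congrArg Quotient.mk'' (eta v)⟩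
  rw [← finrank_range_funLeft q hq]
  have hmk (k : TwoSided G × Equiv.Perm (Fin 3)) (v : Fin 3 → G) :
      (Quotient.mk'' (k • v) :
        MulAction.orbitRel.Quotient (TwoSided G × Equiv.Perm (Fin 3)) (Fin 3 → G)) =
      Quotient.mk'' v := Quotient.sound' ⟨k, rfl⟩
  have hsmul (k : TwoSided G × Equiv.Perm (Fin 3)) (t u : G × G × G)
      (h : k • ![t.1, t.2.1, t.2.2] = ![u.1, u.2.1, u.2.2]) : q u = q t := by
    simp only [q, ← h, hmk]
  suffices h : invariantFunctions₃ G = LinearMap.range (LinearMap.funLeft ℂ ℂ q) by rw [h]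
  ext f
  constructor
  · rintro ⟨h1, h2, h3, h4⟩
    have hinv (k : TwoSided G × Equiv.Perm (Fin 3)) (v : Fin 3 → G) :
        f ((k • v) 0, (k • v) 1, (k • v) 2) = f (v 0, v 1, v 2) := by
      have hγ (γ : TwoSided G) (x y z : G) : f (γ • x, γ • y, γ • z) = f (x, y, z) := by
        obtain ⟨⟨g, h⟩, u⟩ := γ
        rcases Int.units_eq_one_or u with rfl | rfl
        · simp only [TwoSided.smul_one_mk, h3]
        · simp only [TwoSided.smul_neg_one_mk, h3, h4]
      obtain ⟨γ, σ⟩ := k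
      simp only [prodPerm_smul_apply, hγ]
      generalize σ⁻¹ = τ
      have h21 (x y z) : f (z, y, x) = f (x, y, z) := by rw [h1, h2, h1]
      have h120 (x y z) : f (y, z, x) = f (x, y, z) := by rw [h2, h1]
      have h201 (x y z) : f (z, x, y) = f (x, y, z) := by rw [h1, h2]
      have hτ : τ = 1 ∨ τ = Equiv.swap 0 1 ∨ τ = Equiv.swap 0 2 ∨ τ = Equiv.swap 1 2 ∨
          τ = finRotate 3 ∨ τ = (finRotate 3)⁻¹ := by
        revert τ; decide
      rcases hτ with rfl | rfl | rfl | rfl | rfl | rfl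
      · rfl
      · exact h1 _ _ _
      · exact h21 _ _ _
      · exact h2 _ _ _
      · exact h120 _ _ _
      · exact h201 _ _ _
    refine ⟨fun o => Quotient.liftOn' o (fun v => f (v 0, v 1, v 2)) ?_, ?_⟩
    · rintro v w ⟨k, rfl⟩
      exact hinv k w
    · rfl
  · rintro ⟨F, rfl⟩
    refine ⟨fun x y z => ?_, fun x y z => ?_, fun g h x y z => ?_, fun x y z => ?_⟩
    · refine congrArg F (hsmul (1, Equiv.swap 0 1) _ _ ?_)
      ext i; fin_cases i <;> exact one_smul (TwoSided G) _
    · refine congrArg F (hsmul (1, Equiv.swap 1 2) _ _ ?_)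
      ext i; fin_cases i <;> exact one_smul (TwoSided G) _
    · refine congrArg F (hsmul (⟨(g, h), 1⟩, 1) _ _ ?_)
      ext i; fin_cases i <;> rfl
    · refine congrArg F (hsmul (⟨(1, 1), -1⟩, 1) _ _ ?_)
      have hθ (w : G) : (⟨(1, 1), -1⟩ : TwoSided G) • w = w⁻¹ := by
        rw [TwoSided.smul_neg_one_mk, one_mul, inv_one, mul_one]
      ext i; fin_cases i <;> exact hθ _

lemma finrank_invariantFunctions₂ [Finite G] :
    Module.finrank ℂ (invariantFunctions₂ G) =
      Nat.card (MulAction.orbitRel.Quotient (TwoSided G × Equiv.Perm (Fin 2)) (Fin 2 → G)) := by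
  let q : G × G →
      MulAction.orbitRel.Quotient (TwoSided G × Equiv.Perm (Fin 2)) (Fin 2 → G) :=
    fun t => Quotient.mk'' ![t.1, t.2]
  have eta (v : Fin 2 → G) : ![v 0, v 1] = v := by
    ext i; fin_cases i <;> rfl
  have hq : Function.Surjective q := by
    intro o
    induction o using Quotient.inductionOn' with
    | h v => exact ⟨(v 0, v 1), congrArg Quotient.mk'' (eta v)⟩
  rw [← finrank_range_funLeft q hq]
  have hmk (k : TwoSided G × Equiv.Perm (Fin 2)) (v : Fin 2 → G) :
      (Quotient.mk'' (k • v) :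
        MulAction.orbitRel.Quotient (TwoSided G × Equiv.Perm (Fin 2)) (Fin 2 → G)) =
      Quotient.mk'' v := Quotient.sound' ⟨k, rfl⟩
  have hsmul (k : TwoSided G × Equiv.Perm (Fin 2)) (t u : G × G)
      (h : k • ![t.1, t.2] = ![u.1, u.2]) : q u = q t := by
    simp only [q, ← h, hmk]
  suffices h : invariantFunctions₂ G = LinearMap.range (LinearMap.funLeft ℂ ℂ q) by rw [h]
  ext f
  constructor
  · rintro ⟨h1, h2, h3⟩
    have hinv (k : TwoSided G × Equiv.Perm (Fin 2)) (v : Fin 2 → G) :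
        f ((k • v) 0, (k • v) 1) = f (v 0, v 1) := by
      have hγ (γ : TwoSided G) (x y : G) : f (γ • x, γ • y) = f (x, y) := by
        obtain ⟨⟨g, h⟩, u⟩ := γ
        rcases Int.units_eq_one_or u with rfl | rfl
        · simp only [TwoSided.smul_one_mk, h2]
        · simp only [TwoSided.smul_neg_one_mk, h2, h3]
      obtain ⟨γ, σ⟩ := k
      simp only [prodPerm_smul_apply, hγ]
      generalize σ⁻¹ = τ
      have hτ : τ = 1 ∨ τ = Equiv.swap 0 1 := by
        revert τ; decide
      rcases hτ with rfl | rfl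
      · rfl
      · exact h1 _ _
    refine ⟨fun o => Quotient.liftOn' o (fun v => f (v 0, v 1)) ?_, ?_⟩
    · rintro v w ⟨k, rfl⟩
      exact hinv k w
    · rfl
  · rintro ⟨F, rfl⟩
    refine ⟨fun x y => ?_, fun g h x y => ?_, fun x y => ?_⟩
    · refine congrArg F (hsmul (1, Equiv.swap 0 1) _ _ ?_)
      ext i; fin_cases i <;> exact one_smul (TwoSided G) _
    · refine congrArg F (hsmul (⟨(g, h), 1⟩, 1) _ _ ?_)
      ext i; fin_cases i <;> rfl
    · refine congrArg F (hsmul (⟨(1, 1), -1⟩, 1) _ _ ?_)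
      have hθ (w : G) : (⟨(1, 1), -1⟩ : TwoSided G) • w = w⁻¹ := by
        rw [TwoSided.smul_neg_one_mk, one_mul, inv_one, mul_one]
      ext i; fin_cases i <;> exact hθ _

lemma map_sumFirst_invariantFunctions₃ [Fintype G] :
    (invariantFunctions₃ G).map (sumFirst G) = invariantFunctions₂ G := by
  apply le_antisymm
  · rintro _ ⟨f, ⟨h1, h2, h3, h4⟩, rfl⟩
    refine ⟨fun x y => sum_congr rfl fun w _ => h2 _ _ _, fun g h x y => ?_, fun x y => ?_⟩
    · refine (Equiv.sum_comp ((Equiv.mulLeft g).trans (Equiv.mulRight h⁻¹)) _).symm.trans ?_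
      exact sum_congr rfl fun w _ => h3 g h w x y
    · refine (Equiv.sum_comp (Equiv.inv G) _).symm.trans ?_
      exact sum_congr rfl fun w _ => h4 w x y
  · rintro f ⟨h1, h2, h3⟩
    set S : ℂ := ∑ x, f (x, 1) with hS
    have hn : (Fintype.card G : ℂ) ≠ 0 := Nat.cast_ne_zero.mpr Fintype.card_ne_zero
    have hconst (y : G) : ∑ x, f (x, y) = S := by
      rw [hS, ← Equiv.sum_comp (Equiv.mulLeft y)]
      refine sum_congr rfl fun x _ => ?_
      simpa using h2 y 1 x 1
    refine ⟨fun t => (f (t.1, t.2.1) + f (t.2.1, t.2.2) + f (t.1, t.2.2)) / Fintype.card G -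
      2 * S / Fintype.card G ^ 2, ⟨fun x y z => ?_, fun x y z => ?_, fun g h x y z => ?_,
      fun x y z => ?_⟩, ?_⟩
    · simp only [h1 x y]; ring
    · simp only [h1 y z]; ring
    · simp only [h2]
    · simp only [h3]
    · ext ⟨y, z⟩
      simp only [sumFirst, LinearMap.coe_mk, AddHom.coe_mk, sum_sub_distrib, ← sum_div,
        sum_add_distrib, hconst, sum_const, card_univ, nsmul_eq_mul]
      field_simp
      ring

lemma dimAThetaOddGroupAlgebra_eq :
    dimAThetaOddGroupAlgebra G = Module.finrank ℂ (invariantFunctions₃ G) := by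
  rw [dimAThetaOddGroupAlgebra, ← Submodule.span_eq (invariantFunctions₃ G)]
  rfl

lemma dimAThetaOddKerAug_eq [Fintype G] :
    dimAThetaOddKerAug G =
      Module.finrank ℂ ↥(invariantFunctions₃ G ⊓ LinearMap.ker (sumFirst G)) := by
  rw [dimAThetaOddKerAug,
    ← Submodule.span_eq (invariantFunctions₃ G ⊓ LinearMap.ker (sumFirst G))]
  suffices h : { f : G × G × G → ℂ |
      (∀ x y z : G, f (y, x, z) = f (x, y, z)) ∧
      (∀ x y z : G, f (x, z, y) = f (x, y, z)) ∧
      (∀ g h x y z : G, f (g * x * h⁻¹, g * y * h⁻¹, g * z * h⁻¹) = f (x, y, z)) ∧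
      (∀ x y z : G, f (x⁻¹, y⁻¹, z⁻¹) = f (x, y, z)) ∧
      (∀ y z : G, ∑ᶠ x : G, f (x, y, z) = 0) ∧
      (∀ x z : G, ∑ᶠ y : G, f (x, y, z) = 0) ∧
      (∀ x y : G, ∑ᶠ z : G, f (x, y, z) = 0) } =
      (invariantFunctions₃ G ⊓ LinearMap.ker (sumFirst G) : Submodule ℂ (G × G × G → ℂ)) by
    rw [h]
  ext f
  simp only [finsum_eq_sum_of_fintype]
  constructor
  · rintro ⟨h1, h2, h3, h4, h5, -⟩
    exact ⟨⟨h1, h2, h3, h4⟩, funext fun t => h5 t.1 t.2⟩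
  · rintro ⟨⟨h1, h2, h3, h4⟩, h5⟩
    have h5' (y z : G) : ∑ x, f (x, y, z) = 0 := congrFun h5 (y, z)
    refine ⟨h1, h2, h3, h4, h5', fun x z => ?_, fun x y => ?_⟩
    · rw [← h5' x z]
      exact sum_congr rfl fun y _ => h1 _ _ _
    · rw [← h5' x y]
      exact sum_congr rfl fun z _ => by rw [h2, h1]

lemma finrank_add_dimAThetaOddKerAug [Fintype G] :
    Module.finrank ℂ (invariantFunctions₂ G) + dimAThetaOddKerAug G =
      dimAThetaOddGroupAlgebra G := by
  have h := LinearMap.finrank_range_add_finrank_ker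
    ((sumFirst G).domRestrict (invariantFunctions₃ G))
  rw [LinearMap.range_domRestrict, map_sumFirst_invariantFunctions₃, LinearMap.ker_domRestrict,
    ← Submodule.finrank_map_subtype_eq, Submodule.map_comap_subtype] at h
  rw [dimAThetaOddKerAug_eq, dimAThetaOddGroupAlgebra_eq, h]

end dimensions

section rootCounts

lemma centCount_prod {A B : Type*} [Group A] [Fintype A] [DecidableEq A] [Group B] [Fintype B]
    [DecidableEq B] (k : A × B) : centCount k = centCount k.1 * centCount k.2 := by
  simp only [centCount, Prod.ext_iff, Prod.fst_mul, Prod.snd_mul, ← univ_product_univ,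
    filter_product (fun x : A => x * k.1 = k.1 * x) (fun x : B => x * k.2 = k.2 * x), card_product]

lemma rootCount_prod {A B : Type*} [Group A] [Fintype A] [DecidableEq A] [Group B] [Fintype B]
    [DecidableEq B] (n : ℕ) (k : A × B) :
    rootCount n k = rootCount n k.1 * rootCount n k.2 := by
  simp only [rootCount, Prod.ext_iff, Prod.pow_fst, Prod.pow_snd, ← univ_product_univ,
    filter_product (fun x : A => x ^ n = k.1) (fun x : B => x ^ n = k.2), card_product]

variable {A : Type*} [CommGroup A] [Fintype A] [DecidableEq A]

lemma centCount_comm (k : A) : centCount k = Fintype.card A := by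
  simp [centCount, mul_comm k]

lemma rootCount_pow_of_isCyclic [IsCyclic A] (n : ℕ) (k : A) :
    rootCount n (k ^ n) = (Fintype.card A).gcd n := by
  rw [← Nat.card_eq_fintype_card, ← IsCyclic.card_powMonoidHom_ker, rootCount,
    ← Nat.subtype_card _ (fun x => mem_filter_univ x)]
  refine Nat.card_congr (Equiv.subtypeEquiv (Equiv.mulRight k⁻¹) fun x => ?_)
  rw [MonoidHom.mem_ker, powMonoidHom_apply, Equiv.coe_mulRight, mul_pow, inv_pow, mul_inv_eq_one]

lemma rootCount_of_coprime {n : ℕ} (hn : (Fintype.card A).Coprime n) (k : A) :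
    rootCount n k = 1 := by
  rw [← Nat.card_eq_fintype_card] at hn
  rw [rootCount, card_eq_one]
  refine ⟨(powCoprime hn).symm k, ?_⟩
  ext x
  rw [mem_filter_univ, mem_singleton, Equiv.eq_symm_apply, powCoprime_apply]

end rootCounts

lemma ZMod.card_filter_mul_eq_mul (N n : ℕ) [NeZero N] (i : ZMod N) :
    #{j : ZMod N | n * j = n * i} = N.gcd n := by
  have h := rootCount_pow_of_isCyclic n (Multiplicative.ofAdd i)
  rw [Fintype.card_multiplicative, ZMod.card] at h
  rw [← h, rootCount]
  refine card_bij' (fun j _ => Multiplicative.ofAdd j) (fun j _ => j.toAdd) ?_ ?_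
    (by simp) (by simp)
  · intro j hj
    simp only [mem_filter_univ] at hj ⊢
    rw [← ofAdd_nsmul, ← ofAdd_nsmul, nsmul_eq_mul, nsmul_eq_mul, hj]
  · intro j hj
    simp only [mem_filter_univ] at hj ⊢
    have := congrArg Multiplicative.toAdd hj
    rwa [toAdd_pow, toAdd_pow, toAdd_ofAdd, nsmul_eq_mul, nsmul_eq_mul] at this

namespace QuaternionGroup

lemma two_mul_natCast_self {p : ℕ} : (2 * p : ZMod (2 * p)) = 0 := by
  exact_mod_cast ZMod.natCast_self (2 * p)

lemma two_mul_ne_natCast {p : ℕ} (hp : Odd p) (i : ZMod (2 * p)) : 2 * i ≠ p := by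
  intro h
  have := congrArg (ZMod.castHom (dvd_mul_right 2 p) (ZMod 2)) h
  rw [map_mul, map_natCast, map_ofNat, ZMod.natCast_eq_one_iff_odd.mpr hp] at this
  rw [show (2 : ZMod 2) = 0 from rfl, zero_mul] at this
  exact zero_ne_one this

lemma a_pow {p : ℕ} (i : ZMod (2 * p)) (n : ℕ) : (a i) ^ n = a ((n : ZMod (2 * p)) * i) := by
  induction n with
  | zero => simp
  | succ n ih => rw [pow_succ, ih, a_mul_a]; push_cast; ring_nf

lemma xa_pow_three {p : ℕ} (i : ZMod (2 * p)) : (xa i) ^ 3 = xa (i + (p : ZMod (2 * p))) := by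
  rw [pow_succ', xa_sq, xa_mul_a]

variable {p : ℕ} [NeZero p]

/-- The quaternion group as the union of its cyclic subgroup and the other coset. -/
def sumEquiv (p : ℕ) : ZMod (2 * p) ⊕ ZMod (2 * p) ≃ QuaternionGroup p where
  toFun := Sum.elim a xa
  invFun
    | a j => Sum.inl j
    | xa j => Sum.inr j
  left_inv := by rintro (x | x) <;> rfl
  right_inv := by rintro (x | x) <;> rfl

lemma sum_eq {M : Type*} [AddCommMonoid M] (F : QuaternionGroup p → M) :
    ∑ k, F k = ∑ i, F (a i) + ∑ i, F (xa i) := by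
  rw [← (sumEquiv p).sum_comp, Fintype.sum_sum_type]
  rfl

lemma card_filter_eq (P : QuaternionGroup p → Prop) [DecidablePred P] :
    #{k | P k} = #{i | P (a i)} + #{i | P (xa i)} := by
  simp only [card_filter, sum_eq]

lemma card_filter_two_mul_eq (i : ZMod (2 * p)) : #{j : ZMod (2 * p) | 2 * j = 2 * i} = 2 := by
  have h := ZMod.card_filter_mul_eq_mul (2 * p) 2 i
  rw [Nat.gcd_eq_right (dvd_mul_right 2 p)] at h
  exact_mod_cast h

lemma card_filter_two_mul_eq_zero : #{j : ZMod (2 * p) | 2 * j = 0} = 2 := by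
  simpa using card_filter_two_mul_eq (0 : ZMod (2 * p))

lemma centCount_a (i : ZMod (2 * p)) :
    centCount (a i) = 2 * p + if 2 * i = 0 then 2 * p else 0 := by
  rw [centCount, card_filter_eq]
  have h (j : ZMod (2 * p)) : j + i = j - i ↔ 2 * i = 0 := by
    constructor <;> intro h <;> linear_combination h
  by_cases hi : 2 * i = 0 <;> simp [add_comm i, h, hi, ZMod.card]

lemma centCount_xa (i : ZMod (2 * p)) : centCount (xa i) = 4 := by
  rw [centCount, card_filter_eq]
  have h1 (j : ZMod (2 * p)) : i - j = i + j ↔ 2 * j = 0 := by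
    constructor <;> intro h <;> linear_combination -h
  have h2 (j : ZMod (2 * p)) : (p : ZMod (2 * p)) + i - j = p + j - i ↔ 2 * j = 2 * i := by
    constructor <;> intro h <;> linear_combination -h
  simp only [a_mul_xa, xa_mul_a, xa_mul_xa, xa.injEq, a.injEq, h1, h2,
    card_filter_two_mul_eq, card_filter_two_mul_eq_zero]

lemma sum_centCount :
    ∑ k : QuaternionGroup p, centCount k = 4 * p ^ 2 + 12 * p := by
  simp only [sum_eq, centCount_a, centCount_xa, sum_add_distrib, ← sum_filter, sum_const,
    card_univ, ZMod.card, card_filter_two_mul_eq_zero, smul_eq_mul]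
  ring

lemma sum_centCount_sq :
    ∑ k : QuaternionGroup p, centCount k ^ 2 = 8 * p ^ 3 + 24 * p ^ 2 + 32 * p := by
  have h (i : ZMod (2 * p)) : centCount (a i) ^ 2 =
      4 * p ^ 2 + if 2 * i = 0 then 12 * p ^ 2 else 0 := by
    rw [centCount_a]; split_ifs <;> ring
  simp only [sum_eq, h, centCount_xa, sum_add_distrib, ← sum_filter, sum_const,
    card_univ, ZMod.card, card_filter_two_mul_eq_zero, smul_eq_mul]
  ring

lemma sum_centCount_pow_two (hp : Odd p) :
    ∑ k : QuaternionGroup p, centCount (k ^ 2) = 12 * p ^ 2 + 4 * p := by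
  have h4 : #{j : ZMod (2 * p) | 2 * (2 * j) = 0} = 2 := by
    have h := ZMod.card_filter_mul_eq_mul (2 * p) 4 0
    have hg : (2 * p).gcd 4 = 2 := by
      rw [show 4 = 2 * 2 from rfl, Nat.gcd_mul_left, hp.coprime_two_right]
    rw [hg] at h
    refine Eq.trans (congrArg Finset.card (filter_congr fun j _ => ?_)) h
    rw [mul_zero, ← mul_assoc]
    norm_num
  simp only [sum_eq, a_pow, xa_sq, centCount_a, sum_add_distrib, sum_const, card_univ, ZMod.card,
    two_mul_natCast_self, if_true, Nat.cast_ofNat, ← sum_filter, h4, smul_eq_mul]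
  ring

lemma sum_rootCount_three_pow_three :
    ∑ k : QuaternionGroup p, rootCount 3 (k ^ 3) = 2 * p * (2 * p).gcd 3 + 2 * p := by
  have ha (i : ZMod (2 * p)) : rootCount 3 ((a i) ^ 3) = (2 * p).gcd 3 := by
    rw [rootCount, card_filter_eq]
    simp [a_pow, xa_pow_three, ← ZMod.card_filter_mul_eq_mul (2 * p) 3 i]
  have hxa (i : ZMod (2 * p)) : rootCount 3 ((xa i) ^ 3) = 1 := by
    rw [rootCount, card_filter_eq]
    simp [a_pow, xa_pow_three, filter_eq']
  simp only [sum_eq, ha, hxa, sum_const, card_univ, ZMod.card, smul_eq_mul, mul_one]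

lemma rootCount_two_a (j : ZMod (2 * p)) :
    rootCount 2 (a j) = #{i : ZMod (2 * p) | 2 * i = j} + if j = p then 2 * p else 0 := by
  rw [rootCount, card_filter_eq]
  by_cases hj : j = p
  · simp [a_pow, hj, ZMod.card]
  · simp [a_pow, hj, Ne.symm hj]

lemma rootCount_two_xa (j : ZMod (2 * p)) : rootCount 2 (xa j) = 0 := by
  rw [rootCount, card_filter_eq]
  simp [a_pow]

lemma rootCount_two_a_pow_two (hp : Odd p) (i : ZMod (2 * p)) :
    rootCount 2 ((a i) ^ 2) = 2 := by
  rw [a_pow, Nat.cast_ofNat, rootCount_two_a, card_filter_two_mul_eq,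
    if_neg (two_mul_ne_natCast hp i)]

lemma rootCount_two_xa_pow_two (hp : Odd p) (i : ZMod (2 * p)) :
    rootCount 2 ((xa i) ^ 2) = 2 * p := by
  simp [xa_sq, rootCount_two_a, two_mul_ne_natCast hp]

lemma sum_rootCount_two_sq (hp : Odd p) :
    ∑ k : QuaternionGroup p, rootCount 2 k ^ 2 = 4 * p ^ 2 + 4 * p := by
  simp only [pow_two (rootCount 2 _), sum_rootCount_mul, sum_eq, rootCount_two_a_pow_two hp,
    rootCount_two_xa_pow_two hp, sum_const, card_univ, ZMod.card, smul_eq_mul]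
  ring

lemma sum_rootCount_two_cube (hp : Odd p) :
    ∑ k : QuaternionGroup p, rootCount 2 k ^ 3 = 8 * p ^ 3 + 8 * p := by
  have h (k : QuaternionGroup p) : rootCount 2 k ^ 3 = rootCount 2 k * rootCount 2 k ^ 2 :=
    pow_succ' _ _
  simp only [h, sum_rootCount_mul, sum_eq, rootCount_two_a_pow_two hp,
    rootCount_two_xa_pow_two hp, sum_const, card_univ, ZMod.card, smul_eq_mul]
  ring

lemma sum_rootCount_two_pow_three :
    ∑ k : QuaternionGroup p, rootCount 2 (k ^ 3) = 2 * p + 2 * p * (2 * p).gcd 3 := by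
  have h1 : #{i : ZMod (2 * p) | 3 * i = p} = (2 * p).gcd 3 := by
    rw [← ZMod.card_filter_mul_eq_mul (2 * p) 3 p]
    congr 1
    ext j
    have : (3 * p : ZMod (2 * p)) = p := by linear_combination two_mul_natCast_self (p := p)
    simp [this]
  have h2 : ∑ i : ZMod (2 * p), #{j : ZMod (2 * p) | 2 * j = 3 * i} = 2 * p := by
    rw [← card_sigma]
    refine Eq.trans ?_ ((card_univ (α := ZMod (2 * p))).trans (ZMod.card _))
    refine card_bij' (fun t _ => t.2 - t.1) (fun d _ => ⟨2 * d, 3 * d⟩) (by simp) ?_ ?_ ?_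
    · intro d _
      simp only [mem_sigma, mem_univ, mem_filter_univ, true_and]
      ring
    · rintro ⟨i, j⟩ h
      simp only [mem_sigma, mem_univ, mem_filter_univ, true_and] at h
      ext
      · linear_combination h
      · rw [heq_eq_eq]
        linear_combination h
    · intro d _
      ring
  simp only [sum_eq, a_pow, xa_pow_three, rootCount_two_a, rootCount_two_xa, sum_add_distrib,
    Nat.cast_ofNat, h2, ← sum_filter, h1, sum_const, card_univ, smul_eq_mul]
  ring

end QuaternionGroup

section product

variable {m p : ℕ} [NeZero m] [NeZero p]

lemma sum_prod_zmod (F : QuaternionGroup p → ℕ) :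
    ∑ k : Multiplicative (ZMod m) × QuaternionGroup p, F k.2 = m * ∑ b, F b := by
  simp [Fintype.sum_prod_type, ZMod.card]

lemma centCount_prod_zmod (k : Multiplicative (ZMod m) × QuaternionGroup p) :
    centCount k = m * centCount k.2 := by
  rw [centCount_prod, centCount_comm, Fintype.card_multiplicative, ZMod.card]

lemma rootCount_two_prod_zmod (hm : m.Coprime 2)
    (k : Multiplicative (ZMod m) × QuaternionGroup p) : rootCount 2 k = rootCount 2 k.2 := by
  rw [rootCount_prod, rootCount_of_coprime, one_mul]
  rwa [Fintype.card_multiplicative, ZMod.card]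

lemma rootCount_three_prod_zmod (k : Multiplicative (ZMod m) × QuaternionGroup p) :
    rootCount 3 (k ^ 3) = m.gcd 3 * rootCount 3 (k.2 ^ 3) := by
  rw [rootCount_prod, Prod.pow_fst, rootCount_pow_of_isCyclic, Fintype.card_multiplicative,
    ZMod.card, Prod.pow_snd]

lemma finrank_invariantFunctions₂_prod (hm : m.Coprime 2) (hp : Odd p) :
    Module.finrank ℂ (invariantFunctions₂ (Multiplicative (ZMod m) × QuaternionGroup p)) * 2 =
      m * (p + 3) + p + 1 := by
  have h := TwoSided.card_orbits_fin_two (G := Multiplicative (ZMod m) × QuaternionGroup p)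
  rw [← finrank_invariantFunctions₂] at h
  simp only [centCount_prod_zmod, rootCount_two_prod_zmod hm, ← mul_sum] at h
  rw [sum_prod_zmod, sum_prod_zmod (fun b => rootCount 2 b ^ 2),
    QuaternionGroup.sum_centCount, QuaternionGroup.sum_rootCount_two_sq hp, Fintype.card_prod,
    Fintype.card_multiplicative, ZMod.card, QuaternionGroup.card] at h
  have hpos : 0 < 4 * m * p := by have := NeZero.pos m; have := NeZero.pos p; positivity
  refine Nat.eq_of_mul_eq_mul_left hpos ?_
  linarith

lemma dimAThetaOddGroupAlgebra_prod (hm : m.Coprime 2) (hp : Odd p) :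
    dimAThetaOddGroupAlgebra (Multiplicative (ZMod m) × QuaternionGroup p) * 12 =
      2 * m ^ 2 * p ^ 2 + 6 * m ^ 2 * p + 8 * m ^ 2 + 18 * m * p + 6 * m + 2 * p ^ 2 + 3 +
        m.gcd 3 * (p.gcd 3 + 1) + p.gcd 3 := by
  have h := TwoSided.card_orbits_fin_three (G := Multiplicative (ZMod m) × QuaternionGroup p)
  have hg : (2 * p).gcd 3 = p.gcd 3 := Nat.Coprime.gcd_mul_left_cancel p (by norm_num)
  rw [← finrank_invariantFunctions₃, ← dimAThetaOddGroupAlgebra_eq] at h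
  simp only [centCount_prod_zmod, rootCount_two_prod_zmod hm, rootCount_three_prod_zmod, mul_pow,
    Prod.pow_snd, ← mul_sum] at h
  rw [sum_prod_zmod (fun b => centCount b ^ 2), sum_prod_zmod (fun b => centCount (b ^ 2)),
    sum_prod_zmod (fun b => rootCount 3 (b ^ 3)), sum_prod_zmod (fun b => rootCount 2 b ^ 3),
    sum_prod_zmod (fun b => rootCount 2 (b ^ 3)),
    QuaternionGroup.sum_centCount_sq, QuaternionGroup.sum_centCount_pow_two hp,
    QuaternionGroup.sum_rootCount_three_pow_three, QuaternionGroup.sum_rootCount_two_cube hp,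
    QuaternionGroup.sum_rootCount_two_pow_three, Fintype.card_prod,
    Fintype.card_multiplicative, ZMod.card, QuaternionGroup.card, hg] at h
  have hpos : 0 < 4 * m * p := by have := NeZero.pos m; have := NeZero.pos p; positivity
  refine Nat.eq_of_mul_eq_mul_left hpos ?_
  linarith

end product

/-- the dimension formulas for `π = (ℤ/mℤ) × D*₄ₚ`, `p` odd,
`gcd(m, 2p) = 1`. -/
theorem dim_aThetaOdd_zmod_prod_binaryDihedral_odd (m p : ℕ) (hm : 1 ≤ m) (hp : 0 < p)
    (hpo : Odd p) (hcop : Nat.gcd m (2 * p) = 1) :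
    (¬ (3 ∣ p) → ¬ (3 ∣ m) →
      (dimAThetaOddGroupAlgebra (Multiplicative (ZMod m) × QuaternionGroup p) : ℚ)
        = (1/6) * m^2 * p^2 + (1/2) * m^2 * p + (2/3) * m^2 + (3/2) * m * p
          + (1/6) * p^2 + (1/2) * m + 1/2 ∧
      (dimAThetaOddKerAug (Multiplicative (ZMod m) × QuaternionGroup p) : ℚ)
        = (1/6) * m^2 * p^2 + (1/2) * m^2 * p + (2/3) * m^2 + m * p
          + (1/6) * p^2 - m - (1/2) * p) ∧
    ((3 ∣ p ∨ 3 ∣ m) →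
      (dimAThetaOddGroupAlgebra (Multiplicative (ZMod m) × QuaternionGroup p) : ℚ)
        = (1/6) * m^2 * p^2 + (1/2) * m^2 * p + (2/3) * m^2 + (3/2) * m * p
          + (1/6) * p^2 + (1/2) * m + 5/6 ∧
      (dimAThetaOddKerAug (Multiplicative (ZMod m) × QuaternionGroup p) : ℚ)
        = (1/6) * m^2 * p^2 + (1/2) * m^2 * p + (2/3) * m^2 + m * p
          + (1/6) * p^2 - m - (1/2) * p + 1/3) := by
  have : NeZero m := ⟨by omega⟩
  have : NeZero p := ⟨hp.ne'⟩
  have hm2 : m.Coprime 2 := Nat.Coprime.coprime_mul_right_right hcop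
  have hmp : m.Coprime p := Nat.Coprime.coprime_mul_left_right hcop
  have h2 := finrank_invariantFunctions₂_prod hm2 hpo
  have h3 := dimAThetaOddGroupAlgebra_prod hm2 hpo
  have hk := finrank_add_dimAThetaOddKerAug (G := Multiplicative (ZMod m) × QuaternionGroup p)
  generalize dimAThetaOddGroupAlgebra (Multiplicative (ZMod m) × QuaternionGroup p) = d at h3 hk ⊢
  generalize dimAThetaOddKerAug (Multiplicative (ZMod m) × QuaternionGroup p) = e at hk ⊢
  generalize Module.finrank ℂ
    (invariantFunctions₂ (Multiplicative (ZMod m) × QuaternionGroup p)) = r at h2 hk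
  have gcd_three {n : ℕ} (hn : ¬ 3 ∣ n) : n.gcd 3 = 1 :=
    ((Nat.Prime.coprime_iff_not_dvd Nat.prime_three).mpr hn).symm
  have gcd_three' {n : ℕ} (hn : 3 ∣ n) : n.gcd 3 = 3 := Nat.gcd_eq_right hn
  have hk' : (r : ℚ) + e = d := by exact_mod_cast hk
  have h2' : (r : ℚ) * 2 = m * (p + 3) + p + 1 := by exact_mod_cast h2
  refine ⟨fun h3p h3m => ?_, fun h => ?_⟩
  · rw [gcd_three h3p, gcd_three h3m] at h3
    qify at h3
    constructor <;> linarith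
  · have hg : m.gcd 3 * (p.gcd 3 + 1) + p.gcd 3 = 7 := by
      rcases h with h | h
      · have h3m : ¬ 3 ∣ m := fun h' => by
          have := Nat.dvd_gcd h' h
          rw [hmp] at this
          omega
        rw [gcd_three' h, gcd_three h3m]
      · have h3p : ¬ 3 ∣ p := fun h' => by
          have := Nat.dvd_gcd h h'
          rw [hmp] at this
          omega
        rw [gcd_three' h, gcd_three h3p]
    rw [add_assoc, hg] at h3
    qify at h3
    constructor <;> linarith
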